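/- Let G be a connected graph on n ≥ 4 vertices with m edges and minimum degree δ(G) ≥ 2. If m ≥ C(n−2, 2) + 4, then G is traceable from every vertex unless G is isomorphic to one of the following graphs: K₂ ∨ (K_{n−4} + 2K₁), K₅ ∨ 6K₁, K₃ ∨ (K₂ + 3K₁), K₄ ∨ 5K₁, K₃ ∨ (K_{1,4} + K₁), K₃ ∨ (K_{1,3} + K₂), K₂ ∨ K_{2,5}, K₃ ∨ 4K₁, K₂ ∨ (K₁ + K_{1,3}), K₂ ∨ (K_{1,2} + K₂), K₁ ∨ K_{2,4}. -/

import Mathlib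

open SimpleGraph Finset

/-- The transmission of a vertex: sum of distances to all other vertices. -/
noncomputable def transmission {V : Type*} [Fintype V] (G : SimpleGraph V) (u : V) : ℕ :=
  ∑ v, G.dist u v

/-- The transmission σ(G): sum of distances over all unordered pairs. -/
noncomputable def transmissionOf {V : Type*} [Fintype V] (G : SimpleGraph V) : ℝ :=
  (1 / 2) * ∑ u, ∑ v, (G.dist u v : ℝ)

/-- The distance signless Laplacian matrix Q_D(G) = Tr(G) + 𝒟(G). -/
noncomputable def distSignlessLaplacian {V : Type*} [Fintype V] [DecidableEq V]
    (G : SimpleGraph V) : Matrix V V ℝ :=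
  fun u v => (if u = v then (transmission G u : ℝ) else 0) + (G.dist u v : ℝ)

/-- `ρ` is the distance signless Laplacian spectral radius of `G`,
i.e. the largest eigenvalue of `Q_D(G)`. -/
noncomputable def IsDistSLSpectralRadius {V : Type*} [Fintype V] [DecidableEq V]
    (G : SimpleGraph V) (ρ : ℝ) : Prop :=
  IsGreatest {μ : ℝ | Module.End.HasEigenvalue (Matrix.toLin' (distSignlessLaplacian G)) μ} ρ

/-- Join of two graphs. -/
def joinGraph {α β : Type*} (G : SimpleGraph α) (H : SimpleGraph β) : SimpleGraph (α ⊕ β) :=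
  SimpleGraph.fromRel (fun x y =>
    match x, y with
    | Sum.inl a, Sum.inl b => G.Adj a b
    | Sum.inr a, Sum.inr b => H.Adj a b
    | Sum.inl _, Sum.inr _ => True
    | Sum.inr _, Sum.inl _ => False)

/-- The graph H_{t,n-t}. -/
def HGraph (n t : ℕ) : SimpleGraph (Fin n ⊕ Fin n) :=
  SimpleGraph.fromRel (fun x y =>
    match x, y with
    | Sum.inl i, Sum.inr j => (j : ℕ) < n - t ∨ (i : ℕ) < t
    | _, _ => False)

/-- Hamilton-connected. -/
def IsHamiltonianConnected {V : Type*} [DecidableEq V] (G : SimpleGraph V) : Prop :=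
  ∀ u v : V, u ≠ v → ∃ p : G.Walk u v, p.IsHamiltonian

/-- Traceable from every vertex. -/
def TraceableFromEveryVertex {V : Type*} [DecidableEq V] (G : SimpleGraph V) : Prop :=
  ∀ u : V, ∃ v : V, ∃ p : G.Walk u v, p.IsHamiltonian

/-- K_{n-1} + e : complete graph on n-1 vertices with a pendant edge. -/
def KPlusPendant (n : ℕ) : SimpleGraph (Fin (n - 1) ⊕ Fin 1) :=
  SimpleGraph.fromRel (fun x y =>
    match x, y with
    | Sum.inl a, Sum.inl b => a ≠ b
    | Sum.inl a, Sum.inr _ => (a : ℕ) = 0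
    | _, _ => False)

/-- A Hamilton path starting at `x`, recorded as the list of its vertices. -/
def HasHamiltonListFrom {V : Type*} (G : SimpleGraph V) (x : V) : Prop :=
  ∃ l : List V, l.head? = some x ∧ l.IsChain G.Adj ∧ l.Nodup ∧ ∀ v, v ∈ l

theorem HasHamiltonListFrom.exists_walk {V : Type*} [DecidableEq V] {G : SimpleGraph V} {x : V}
    (h : HasHamiltonListFrom G x) : ∃ v : V, ∃ p : G.Walk x v, p.IsHamiltonian := by
  obtain ⟨l, hx, hc, hn, hv⟩ := h
  have hne : l ≠ [] := by rintro rfl; simp at hx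
  obtain rfl : l.head hne = x := by
    rw [List.head?_eq_some_head hne] at hx
    exact Option.some.inj hx
  refine ⟨_, Walk.ofSupport l hne hc, fun a => ?_⟩
  rw [Walk.support_ofSupport]
  exact List.count_eq_one_of_mem hn (hv a)

theorem hasHamiltonListFrom_top {V : Type*} [Fintype V] [DecidableEq V] (x : V) :
    HasHamiltonListFrom (⊤ : SimpleGraph V) x := by
  have hn : (x :: (univ.erase x).toList).Nodup := by simp [Finset.nodup_toList]
  refine ⟨x :: (univ.erase x).toList, rfl, ?_, hn, fun v => ?_⟩
  · exact hn.isChain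
  · by_cases h : v = x <;> simp [h]

/-- If no two consecutive entries satisfy `p` and `q` respectively, then the entries satisfying
`p` and the predecessors of the entries satisfying `q` do not overlap. -/
theorem List.countP_add_countP_tail_le {α : Type*} (p q : α → Bool) (a : α) (t : List α)
    (h : (a :: t).IsChain fun x y => ¬(p x ∧ q y)) :
    (a :: t).countP p + t.countP q ≤
      t.length + if p ((a :: t).getLast (List.cons_ne_nil a t)) then 1 else 0 := by
  induction t generalizing a with
  | nil => simp [List.countP_cons]; rfl
  | cons b t ih =>
    rw [List.isChain_cons_cons] at h
    have := ih b h.2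
    rw [List.countP_cons, List.countP_cons (p := q), List.getLast_cons (List.cons_ne_nil b t),
      List.length_cons]
    have h1 := h.1
    cases hp : p a <;> cases hq : q b <;> simp [hp, hq] at h1 ⊢ <;> omega

theorem SimpleGraph.countP_adj_eq_degree {V : Type*} [Fintype V] [DecidableEq V]
    (G : SimpleGraph V) [DecidableRel G.Adj] {l : List V} (hn : l.Nodup) (hl : ∀ v, v ∈ l) (u : V) :
    l.countP (fun w => G.Adj u w) = G.degree u := by
  rw [List.countP_eq_length_filter, ← List.toFinset_card_of_nodup (hn.filter _),
    ← G.card_neighborFinset_eq_degree]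
  congr 1
  ext w
  simp [hl]

theorem SimpleGraph.isChain_adj_reverse {V : Type*} {G : SimpleGraph V} {l : List V}
    (h : l.IsChain G.Adj) : l.reverse.IsChain G.Adj := by
  rw [List.isChain_reverse]
  exact h.imp fun _ _ hab => hab.symm

theorem hasHamiltonListFrom_of_append {V : Type*} [Fintype V] [DecidableEq V] {G : SimpleGraph V}
    [DecidableRel G.Adj] {x u v : V} (hnadj : ¬G.Adj u v)
    (hd : Fintype.card V ≤ G.degree u + G.degree v) {s t : List V}
    (hx : (s ++ [u]).head? = some x) (hs : (s ++ [u]).IsChain G.Adj) (ht : (v :: t).IsChain G.Adj)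
    (hn : (s ++ [u] ++ v :: t).Nodup) (hm : ∀ w, w ∈ s ++ [u] ++ v :: t) :
    HasHamiltonListFrom G x := by
  have key : ∀ r : List V, r.Perm (s ++ [u] ++ v :: t) → r.head? = some x → r.IsChain G.Adj →
      HasHamiltonListFrom G x := fun r hr hx hc =>
    ⟨r, hx, hc, hr.nodup_iff.2 hn, fun w => hr.mem_iff.2 (hm w)⟩
  by_cases hlast : G.Adj u ((v :: t).getLast (List.cons_ne_nil v t))
  · refine key (s ++ [u] ++ (v :: t).reverse) ((List.reverse_perm _).append_left _)
      (by simpa using hx) ?_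
    rw [List.isChain_append]
    refine ⟨hs, isChain_adj_reverse ht, ?_⟩
    simp only [List.getLast?_append, List.getLast?_singleton, List.head?_reverse]
    rw [List.getLast?_eq_some_getLast (List.cons_ne_nil v t)]
    simpa using hlast
  by_cases h1 : (s ++ [u]).IsChain fun a b => ¬(G.Adj u a ∧ G.Adj v b)
  · by_cases h2 : (v :: t).IsChain fun a b => ¬(G.Adj u a ∧ G.Adj v b)
    · exfalso
      have e1 := G.countP_adj_eq_degree hn hm u
      have e2 := G.countP_adj_eq_degree hn hm v
      have c2 := List.countP_add_countP_tail_le (fun w => decide (G.Adj u w))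
        (fun w => decide (G.Adj v w)) v t (by simpa using h2)
      have hcard : (s ++ [u] ++ v :: t).length = Fintype.card V := by
        rw [← List.toFinset_card_of_nodup hn, ← Finset.card_univ]
        congr 1
        ext w
        simp only [List.mem_toFinset, hm w, Finset.mem_univ]
      obtain ⟨a, r, har⟩ := List.exists_cons_of_ne_nil (l := s ++ [u]) (by simp)
      have hgl : (a :: r).getLast (List.cons_ne_nil a r) = u := by
        simp only [← har, List.getLast_append_singleton]
      rw [har] at h1 e1 e2 hcard
      have c1 := List.countP_add_countP_tail_le (fun w => decide (G.Adj u w))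
        (fun w => decide (G.Adj v w)) a r (by simpa using h1)
      rw [hgl] at c1
      rw [List.countP_append] at e1 e2
      rw [List.countP_cons] at c1 c2 e1 e2
      simp only [List.length_append, List.length_cons, hlast, G.irrefl] at hcard c1 c2 e1 e2
      rw [List.countP_cons] at e1 e2
      have hb : (if decide (G.Adj v a) = true then 1 else 0) ≤ 1 := by split <;> omega
      simp only [hnadj] at *
      simp at *
      omega
    · rw [List.isChain_iff_forall_rel_of_append_cons_cons] at h2
      push Not at h2
      obtain ⟨c, d, t₁, t₂, h2, hc, hd⟩ := h2
      have ht' := ht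
      rw [h2, List.isChain_append_cons_cons] at ht'
      refine key (s ++ [u] ++ ((t₁ ++ [c]).reverse ++ d :: t₂)) ?_ (by simpa using hx) ?_
      · rw [h2]
        rw [List.perm_iff_count]
        intro a
        simp only [List.count_append, List.count_reverse, List.count_cons, List.count_nil]
        omega
      · have hh : (t₁ ++ [c]).head? = some v := by
          have := congrArg List.head? h2
          cases t₁ <;> simp_all
        refine List.isChain_append.2 ⟨hs,
          List.isChain_append.2 ⟨isChain_adj_reverse ht'.1, ht'.2.2, ?_⟩, ?_⟩
        · rw [List.getLast?_reverse, hh]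
          simpa using hd
        · simpa using hc
  · rw [List.isChain_iff_forall_rel_of_append_cons_cons] at h1
    push Not at h1
    obtain ⟨c, d, s₁, s₂, h1, hc, hd⟩ := h1
    have hs' := hs
    rw [h1, List.isChain_append_cons_cons] at hs'
    refine key (s₁ ++ [c] ++ (d :: s₂).reverse ++ v :: t) ?_ ?_ ?_
    · rw [h1]
      rw [List.perm_iff_count]
      intro a
      simp only [List.count_append, List.count_reverse, List.count_cons, List.count_nil]
      omega
    · rw [h1] at hx
      cases s₁ <;> simp_all
    · have hh : (d :: s₂).getLast? = some u := by
        have := congrArg List.getLast? h1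
        simpa [List.getLast?_append, List.getLast?_cons] using this.symm
      refine List.isChain_append.2 ⟨List.isChain_append.2
        ⟨hs'.1, isChain_adj_reverse hs'.2.2, ?_⟩, ht, ?_⟩
      · rw [List.head?_reverse, hh]
        simpa using hc.symm
      · rw [List.getLast?_append, List.getLast?_reverse]
        simpa using hd.symm

theorem HasHamiltonListFrom.of_sup_edge {V : Type*} [Fintype V] [DecidableEq V]
    {G : SimpleGraph V} [DecidableRel G.Adj] {x u v : V} (hnadj : ¬G.Adj u v)
    (hd : Fintype.card V ≤ G.degree u + G.degree v)
    (h : HasHamiltonListFrom (G ⊔ edge u v) x) : HasHamiltonListFrom G x := by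
  obtain ⟨l, hx, hc, hn, hm⟩ := h
  by_cases hG : l.IsChain G.Adj
  · exact ⟨l, hx, hG, hn, hm⟩
  rw [List.isChain_iff_forall_rel_of_append_cons_cons] at hG
  push Not at hG
  obtain ⟨a, b, s, t, rfl, hab⟩ := hG
  rw [List.isChain_append_cons_cons] at hc
  obtain ⟨hs, he, ht⟩ := hc
  have hdist : ∀ y ∈ s ++ [a], ∀ z ∈ b :: t, y ≠ z := by
    rw [List.append_cons, List.nodup_append] at hn
    exact hn.2.2
  have huv : a = u ∧ b = v ∨ a = v ∧ b = u := by
    simp only [sup_adj, hab, edge_adj, false_or] at he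
    exact he.1
  have hs' : (s ++ [a]).IsChain G.Adj := by
    refine hs.imp_of_mem_imp fun y z hy hz hyz => ?_
    have h1 := hdist y hy b (by simp)
    have h2 := hdist z hz b (by simp)
    simp only [sup_adj, edge_adj] at hyz
    grind
  have ht' : (b :: t).IsChain G.Adj := by
    refine ht.imp_of_mem_imp fun y z hy hz hyz => ?_
    have h1 := hdist a (by simp) y hy
    have h2 := hdist a (by simp) z hz
    simp only [sup_adj, edge_adj] at hyz
    grind
  have hx' : (s ++ [a]).head? = some x := by cases s <;> simp_all
  rw [List.append_cons] at hn hm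
  refine hasHamiltonListFrom_of_append hab ?_ hx' hs' ht' hn hm
  rcases huv with ⟨rfl, rfl⟩ | ⟨rfl, rfl⟩ <;> omega

/-- A graph that is not traceable from `x` extends to one in which any two non-adjacent vertices
have degree sum less than the order. -/
theorem exists_degree_closed_supergraph {V : Type*} [Fintype V] [DecidableEq V]
    {G : SimpleGraph V} {x : V} (h : ¬HasHamiltonListFrom G x) :
    ∃ (H : SimpleGraph V) (_ : DecidableRel H.Adj), G ≤ H ∧ H ≠ ⊤ ∧
      ∀ u v, u ≠ v → ¬H.Adj u v → H.degree u + H.degree v < Fintype.card V := by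
  classical
  obtain ⟨H, hGH, hH⟩ := (Set.toFinite {H : SimpleGraph V | ¬HasHamiltonListFrom H x}).exists_le_maximal h
  refine ⟨H, inferInstance, hGH, ?_, fun u v huv hadj => ?_⟩
  · rintro rfl
    exact hH.prop (hasHamiltonListFrom_top x)
  · by_contra! hd
    refine hH.prop (HasHamiltonListFrom.of_sup_edge hadj hd ?_)
    by_contra hn
    have hle := hH.le_of_ge (y := H ⊔ edge u v) hn le_sup_left
    exact hadj (hle (Or.inr (by simp [edge_adj, huv])))

/-- Chvátal's degree obstruction, extracted from a non-adjacent pair of largest degree sum. -/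
theorem exists_low_degree_sets {V : Type*} [Fintype V] [DecidableEq V] {H : SimpleGraph V}
    [DecidableRel H.Adj] (htop : H ≠ ⊤)
    (hH : ∀ u v, u ≠ v → ¬H.Adj u v → H.degree u + H.degree v < Fintype.card V) :
    ∃ u, ∃ A C : Finset V, 2 * H.degree u + 1 ≤ Fintype.card V ∧ A ⊆ C ∧ #A = H.degree u ∧
      #C = Fintype.card V - H.degree u ∧ (∀ v ∈ A, H.degree v ≤ H.degree u) ∧
      ∀ v ∈ C, H.degree v ≤ Fintype.card V - 1 - H.degree u := by
  have hne : (univ.filter fun p : V × V => p.1 ≠ p.2 ∧ ¬H.Adj p.1 p.2).Nonempty := by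
    by_contra hcon
    rw [Finset.not_nonempty_iff_eq_empty] at hcon
    refine htop (eq_top_iff.2 fun a b hab => ?_)
    by_contra hn
    have : (a, b) ∈ univ.filter fun p : V × V => p.1 ≠ p.2 ∧ ¬H.Adj p.1 p.2 := by
      simpa using ⟨hab.ne, hn⟩
    simp [hcon] at this
  obtain ⟨⟨u, v⟩, huv, hmax⟩ :=
    exists_max_image _ (fun p : V × V => H.degree p.1 + H.degree p.2) hne
  simp only [mem_filter, mem_univ, true_and, Prod.forall] at huv hmax
  wlog hle : H.degree u ≤ H.degree v generalizing u v
  · refine this v u ⟨huv.1.symm, fun h => huv.2 h.symm⟩ (fun a b hab => ?_) (by omega)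
    have := hmax a b hab
    omega
  have hlt := hH u v huv.1 huv.2
  set B := univ.filter fun w => w ≠ v ∧ ¬H.Adj v w with hB
  set D := univ.filter fun w => ¬H.Adj u w with hD
  have hcompl : ∀ w, #(univ.filter fun y => ¬H.Adj w y) = Fintype.card V - H.degree w := by
    intro w
    rw [← H.card_neighborFinset_eq_degree, ← card_compl]
    congr 1
    ext y
    simp
  have hBcard : #B = Fintype.card V - H.degree v - 1 := by
    rw [← hcompl v, ← card_erase_of_mem (a := v) (by simp)]
    congr 1
    ext y
    simp [hB]
  obtain ⟨A, hAB, hA⟩ := exists_subset_card_eq (s := B) (n := H.degree u) (by omega)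
  have hAdeg : ∀ w ∈ A, H.degree w ≤ H.degree u := by
    intro w hw
    have := hAB hw
    simp only [hB, mem_filter, mem_univ, true_and] at this
    have := hmax w v ⟨this.1, fun h => this.2 h.symm⟩
    omega
  have hDdeg : ∀ w ∈ D, H.degree w ≤ Fintype.card V - 1 - H.degree u := by
    intro w hw
    simp only [hD, mem_filter, mem_univ, true_and] at hw
    by_cases hwu : w = u
    · subst hwu
      omega
    · have := hH u w (Ne.symm hwu) hw
      omega
  obtain ⟨C, hAC, hCu, hC⟩ := exists_subsuperset_card_eq (s := A) (t := A ∪ D)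
    (n := Fintype.card V - H.degree u) subset_union_left (by omega)
    ((hcompl u).symm.le.trans (card_le_card subset_union_right))
  refine ⟨u, A, C, by omega, hAC, hA, hC, hAdeg, fun w hw => ?_⟩
  rcases mem_union.1 (hCu hw) with hw | hw
  · have := hAdeg w hw
    omega
  · exact hDdeg w hw

theorem sum_degree_bounds {V : Type*} [Fintype V] [DecidableEq V] {A C : Finset V} {j n : ℕ}
    (hn : Fintype.card V = n) (hAC : A ⊆ C) (hA : #A = j) (hC : #C = n - j) (hj : 2 * j + 1 ≤ n) :
    ∑ v : V, (if v ∈ A then j else if v ∈ C then n - 1 - j else n - 1) =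
      j * j + (n - 2 * j) * (n - 1 - j) + j * (n - 1) := by
  rw [← sum_add_sum_compl C, ← sum_sdiff hAC]
  have e1 : ∑ v ∈ C \ A, (if v ∈ A then j else if v ∈ C then n - 1 - j else n - 1) =
      ∑ v ∈ C \ A, (n - 1 - j) := by
    refine sum_congr rfl fun v hv => ?_
    simp only [mem_sdiff] at hv
    simp [hv]
  have e2 : ∑ v ∈ A, (if v ∈ A then j else if v ∈ C then n - 1 - j else n - 1) =
      ∑ v ∈ A, j := sum_congr rfl fun v hv => by simp [hv]
  have e3 : ∑ v ∈ Cᶜ, (if v ∈ A then j else if v ∈ C then n - 1 - j else n - 1) =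
      ∑ v ∈ Cᶜ, (n - 1) := by
    refine sum_congr rfl fun v hv => ?_
    rw [mem_compl] at hv
    have : v ∉ A := fun h => hv (hAC h)
    simp [hv, this]
  have c1 : #(C \ A) = n - 2 * j := by rw [card_sdiff_of_subset hAC]; omega
  have c3 : #Cᶜ = j := by rw [card_compl]; omega
  rw [e1, e2, e3]
  simp only [sum_const, smul_eq_mul, c1, c3, hA]
  ring

theorem eq_of_degree_sum_bound {n j : ℕ} (hj2 : 2 ≤ j) (hj : 2 * j + 1 ≤ n)
    (h : (n - 2) * (n - 3) + 8 ≤ j * j + (n - 2 * j) * (n - 1 - j) + j * (n - 1)) :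
    j = 2 ∨ n = 8 ∧ j = 3 ∨ n = 2 * j + 1 ∧ (j = 3 ∨ j = 4 ∨ j = 5) := by
  obtain ⟨k, rfl⟩ := Nat.exists_eq_add_of_le hj
  obtain ⟨i, rfl⟩ := Nat.exists_eq_add_of_le hj2
  have e1 : 2 * (2 + i) + 1 + k - 2 = 2 * i + k + 3 := by omega
  have e2 : 2 * (2 + i) + 1 + k - 3 = 2 * i + k + 2 := by omega
  have e3 : 2 * (2 + i) + 1 + k - 2 * (2 + i) = k + 1 := by omega
  have e4 : 2 * (2 + i) + 1 + k - 1 - (2 + i) = i + k + 2 := by omega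
  have e5 : 2 * (2 + i) + 1 + k - 1 = 2 * i + k + 4 := by omega
  rw [e1, e2, e3, e4, e5] at h
  have h' : i * (i + 2 * k) ≤ i * 3 := by nlinarith
  rcases Nat.eq_zero_or_pos i with rfl | hi
  · simp
  · have := Nat.le_of_mul_le_mul_left h' hi
    omega

/-- When the degree bounds of the obstruction are attained, the adjacency is determined. -/
theorem adj_iff_of_degrees_tight {V : Type*} [Fintype V] [DecidableEq V] {G : SimpleGraph V}
    [DecidableRel G.Adj] {A C : Finset V} {j n : ℕ} (hn : Fintype.card V = n) (hAC : A ⊆ C)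
    (hA : #A = j) (hC : #C = n - j) (hj : 2 * j + 1 ≤ n) (hdA : ∀ v ∈ A, G.degree v ≤ j)
    (hdC : ∀ v ∈ C, G.degree v ≤ n - 1 - j)
    (hsum : j * j + (n - 2 * j) * (n - 1 - j) + j * (n - 1) ≤ ∑ v, G.degree v) (u v : V) :
    G.Adj u v ↔ u ≠ v ∧ (u ∉ C ∨ v ∉ C ∨ u ∉ A ∧ v ∉ A) := by
  have hle : ∀ v ∈ univ, G.degree v ≤ if v ∈ A then j else if v ∈ C then n - 1 - j else n - 1 := by
    intro v _
    have := G.degree_lt_card_verts v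
    split_ifs with h1 h2
    · exact hdA v h1
    · exact hdC v h2
    · omega
  have heq := (sum_eq_sum_iff_of_le hle).1
    ((sum_le_sum hle).antisymm ((sum_degree_bounds hn hAC hA hC hj).trans_le hsum))
  have hfull : ∀ v, v ∉ C → ∀ w, w ≠ v → G.Adj v w := by
    intro v hv w hw
    have h1 := heq v (mem_univ v)
    rw [if_neg (fun h => hv (hAC h)), if_neg hv] at h1
    have h2 : G.neighborFinset v = univ.erase v := by
      refine eq_of_subset_of_card_le (fun y hy => ?_) ?_
      · simpa using ((G.mem_neighborFinset v y).1 hy).ne'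
      · rw [card_erase_of_mem (mem_univ v), card_univ, card_neighborFinset_eq_degree]
        omega
    rw [← mem_neighborFinset, h2]
    simpa using hw
  have hlow : ∀ v ∈ A, ∀ w, G.Adj v w → w ∉ C := by
    intro v hv w hw
    have h1 := heq v (mem_univ v)
    rw [if_pos hv] at h1
    have h2 : Cᶜ = G.neighborFinset v := by
      refine eq_of_subset_of_card_le (fun y hy => ?_) ?_
      · rw [mem_compl] at hy
        rw [mem_neighborFinset]
        exact (hfull y hy v (by rintro rfl; exact hy (hAC hv))).symm
      · rw [card_compl, card_neighborFinset_eq_degree]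
        omega
    rw [← mem_neighborFinset, ← h2, mem_compl] at hw
    exact hw
  have hmid : ∀ v ∈ C, v ∉ A → ∀ w, w ≠ v → w ∉ A → G.Adj v w := by
    intro v hv hvA w hw hwA
    have h1 := heq v (mem_univ v)
    rw [if_neg hvA, if_pos hv] at h1
    have h2 : G.neighborFinset v = Aᶜ.erase v := by
      refine eq_of_subset_of_card_le (fun y hy => ?_) ?_
      · rw [mem_neighborFinset] at hy
        rw [mem_erase, mem_compl]
        exact ⟨hy.ne', fun h => hlow y h v hy.symm hv⟩
      · rw [card_erase_of_mem (by simpa using hvA), card_compl, card_neighborFinset_eq_degree]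
        omega
    rw [← mem_neighborFinset, h2]
    simp [hw, hwA]
  constructor
  · intro h
    refine ⟨h.ne, ?_⟩
    by_contra! hcon
    by_cases huA : u ∈ A
    · exact hlow u huA v h hcon.2.1
    · exact hlow v (hcon.2.2 huA) u h.symm hcon.1
  · rintro ⟨hne, h | h | h⟩
    · exact hfull u h v hne.symm
    · exact (hfull v h u hne).symm
    · by_cases hu : u ∈ C
      · exact hmid u hu h.1 v hne.symm h.2
      · exact hfull u hu v hne.symm

/-- In the odd case `n = 2j + 1`, the low-degree vertices form an independent set. -/
theorem not_adj_of_low_degree {V : Type*} [Fintype V] [DecidableEq V] {H : SimpleGraph V}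
    [DecidableRel H.Adj] {C : Finset V} {j : ℕ} (hn : Fintype.card V = 2 * j + 1) (hj : 1 ≤ j)
    (hC : #C = j + 1) (hdC : ∀ v ∈ C, H.degree v ≤ j)
    (hH : ∀ u v, u ≠ v → ¬H.Adj u v → H.degree u + H.degree v < Fintype.card V)
    (hsum : (2 * j - 1) * (2 * j - 2) + 8 ≤ ∑ v, H.degree v) {a b : V} (ha : a ∈ C) (hb : b ∈ C) :
    ¬H.Adj a b := by
  have hCc : #Cᶜ = j := by rw [card_compl]; omega
  have hcross : ∀ h ∉ C, H.Adj a h := by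
    intro h hh
    by_contra hadj
    have hlt := hH a h (by rintro rfl; exact hh ha) hadj
    have s1 : ∑ v ∈ C.erase a, H.degree v ≤ j * j := by
      refine (sum_le_card_nsmul _ _ j fun v hv => hdC v (mem_of_mem_erase hv)).trans ?_
      rw [card_erase_of_mem ha, hC, smul_eq_mul, Nat.add_sub_cancel]
    have s2 : ∑ v ∈ Cᶜ.erase h, H.degree v ≤ (j - 1) * (2 * j) := by
      refine (sum_le_card_nsmul _ _ (2 * j) fun v _ => ?_).trans ?_
      · have := H.degree_lt_card_verts v
        omega
      · rw [card_erase_of_mem (by simpa using hh), hCc, smul_eq_mul]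
    rw [← sum_add_sum_compl C, ← add_sum_erase C _ ha,
      ← add_sum_erase Cᶜ _ (mem_compl.2 hh)] at hsum
    obtain ⟨i, rfl⟩ := Nat.exists_eq_add_of_le hj
    have e1 : 2 * (1 + i) - 1 = 2 * i + 1 := by omega
    have e2 : 2 * (1 + i) - 2 = 2 * i := by omega
    have e3 : 1 + i - 1 = i := by omega
    rw [e1, e2] at hsum
    rw [e3] at s2
    zify at *
    nlinarith [sq_nonneg ((i : ℤ) - 2)]
  have hN : Cᶜ = H.neighborFinset a := by
    refine eq_of_subset_of_card_le (fun y hy => ?_) ?_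
    · rw [mem_neighborFinset]
      exact hcross y (mem_compl.1 hy)
    · rw [hCc, card_neighborFinset_eq_degree]
      exact hdC a ha
  rw [← mem_neighborFinset, ← hN, mem_compl]
  exact fun h => h hb

/-- A graph on `2j + 1` vertices with an independent set `C` of size `j + 1` and at most one edge
fewer than the maximum misses at most one of the remaining pairs. -/
theorem adj_iff_of_independent {V : Type*} [Fintype V] [DecidableEq V] {G : SimpleGraph V}
    [DecidableRel G.Adj] {C : Finset V} {j : ℕ} (hn : Fintype.card V = 2 * j + 1)
    (hC : #C = j + 1) (hind : ∀ a ∈ C, ∀ b ∈ C, ¬G.Adj a b)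
    (hm : 3 * (j * j) + j ≤ 2 * #G.edgeFinset + 2) :
    (∀ u v, G.Adj u v ↔ u ≠ v ∧ ¬(u ∈ C ∧ v ∈ C)) ∨
      2 * #G.edgeFinset + 2 ≤ 3 * (j * j) + j ∧ ∃ a b, a ≠ b ∧ ¬(a ∈ C ∧ b ∈ C) ∧
        ∀ u v, G.Adj u v ↔ u ≠ v ∧ ¬(u ∈ C ∧ v ∈ C) ∧ s(u, v) ≠ s(a, b) := by
  let K : SimpleGraph V :=
    { Adj := fun u v => u ≠ v ∧ ¬(u ∈ C ∧ v ∈ C)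
      symm := ⟨fun u v h => ⟨h.1.symm, fun hc => h.2 hc.symm⟩⟩
      loopless := ⟨fun u h => h.1 rfl⟩ }
  have hK : ∀ u v, K.Adj u v ↔ u ≠ v ∧ ¬(u ∈ C ∧ v ∈ C) := fun u v => Iff.rfl
  have : DecidableRel K.Adj := fun u v => decidable_of_iff _ (hK u v).symm
  have hGK : G ≤ K := fun u v h => ⟨h.ne, fun hc => hind u hc.1 v hc.2 h⟩
  have hCc : #Cᶜ = j := by rw [card_compl]; omega
  have hKsum : 2 * #K.edgeFinset ≤ 3 * (j * j) + j := by
    rw [← K.sum_degrees_eq_twice_card_edges, ← sum_add_sum_compl C]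
    have s1 : ∑ v ∈ C, K.degree v ≤ (j + 1) * j := by
      refine (sum_le_card_nsmul _ _ j fun v hv => ?_).trans_eq (by rw [hC, smul_eq_mul])
      rw [← hCc, ← card_neighborFinset_eq_degree]
      refine card_le_card fun w hw => ?_
      rw [mem_neighborFinset, hK] at hw
      exact mem_compl.2 fun h => hw.2 ⟨hv, h⟩
    have s2 : ∑ v ∈ Cᶜ, K.degree v ≤ j * (2 * j) := by
      refine (sum_le_card_nsmul _ _ (2 * j) fun v _ => ?_).trans_eq (by rw [hCc, smul_eq_mul])
      have := K.degree_lt_card_verts v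
      omega
    nlinarith
  have hsub : G.edgeFinset ⊆ K.edgeFinset := edgeFinset_subset_edgeFinset.2 hGK
  have hcard := card_sdiff_add_card_eq_card hsub
  rcases Nat.eq_zero_or_pos #(K.edgeFinset \ G.edgeFinset) with h0 | hpos
  · left
    rw [card_eq_zero, sdiff_eq_empty_iff_subset] at h0
    have : G = K := le_antisymm hGK (edgeFinset_subset_edgeFinset.1 h0)
    intro u v
    rw [← hK, this]
  · right
    refine ⟨by omega, ?_⟩
    obtain ⟨e, he⟩ := card_eq_one.1 (by omega : #(K.edgeFinset \ G.edgeFinset) = 1)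
    induction e using Sym2.ind with
    | _ a b =>
    have hab : s(a, b) ∈ K.edgeFinset \ G.edgeFinset := by rw [he]; exact mem_singleton_self _
    rw [mem_sdiff, mem_edgeFinset, mem_edgeFinset, mem_edgeSet, mem_edgeSet, hK] at hab
    refine ⟨a, b, hab.1.1, hab.1.2, fun u v => ⟨fun h => ?_, fun h => ?_⟩⟩
    · refine ⟨(hGK h).1, (hGK h).2, fun heq => hab.2 ?_⟩
      rw [← mem_edgeSet, ← heq]
      exact h
    · by_contra hn
      refine h.2.2 (mem_singleton.1 ?_)
      rw [← he, mem_sdiff, mem_edgeFinset, mem_edgeFinset, mem_edgeSet, mem_edgeSet, hK]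
      exact ⟨⟨h.1, h.2.1⟩, hn⟩

/-- Two graphs whose adjacency depends only on a vertex colouring, by the same rule, are isomorphic
as soon as the colour classes have equal sizes. -/
theorem nonempty_iso_of_colouring {V W ι : Type*} [Fintype V] [Fintype W] [DecidableEq ι]
    {G : SimpleGraph V} {H : SimpleGraph W} (c : V → ι) (d : W → ι) (R : ι → ι → Prop)
    (S : ι → Finset V) (hS : ∀ i v, c v = i ↔ v ∈ S i)
    (hcard : ∀ i, #(S i) = #(univ.filter fun w => d w = i))
    (hG : ∀ u v, G.Adj u v ↔ u ≠ v ∧ R (c u) (c v))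
    (hH : ∀ u v, H.Adj u v ↔ u ≠ v ∧ R (d u) (d v)) : Nonempty (G ≃g H) := by
  have hfib : ∀ i, Nonempty ({v // c v = i} ≃ {w // d w = i}) := fun i =>
    Fintype.card_eq.1 (by
      rw [Fintype.card_subtype, Fintype.card_subtype, ← hcard i]
      congr 1
      ext v
      simp [hS])
  let e : V ≃ W := Equiv.ofFiberEquiv fun i => (hfib i).some
  have he : ∀ v, d (e v) = c v := fun v => Equiv.ofFiberEquiv_map _ v
  exact ⟨⟨e, by intro u v; rw [hG, hH, he, he, e.injective.ne_iff]⟩⟩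

theorem card_filter_sum_elim_eq {α β ι : Type*} [Fintype α] [Fintype β] [DecidableEq ι]
    (f : α → ι) (g : β → ι) (i : ι) : #(univ.filter fun w => Sum.elim f g w = i) =
      #(univ.filter fun a => f a = i) + #(univ.filter fun b => g b = i) := by
  rw [← Fintype.card_subtype, ← Fintype.card_subtype, ← Fintype.card_subtype, ← Fintype.card_sum]
  exact Fintype.card_congr Equiv.subtypeSum

theorem nonempty_iso_join_top_sum_bot {V : Type*} [Fintype V] [DecidableEq V] {G : SimpleGraph V}
    {A C : Finset V} (hAC : A ⊆ C) {a b d : ℕ} (hd : #Cᶜ = d) (hb : #(C \ A) = b) (ha : #A = a)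
    (hadj : ∀ u v, G.Adj u v ↔ u ≠ v ∧ (u ∉ C ∨ v ∉ C ∨ u ∉ A ∧ v ∉ A)) :
    Nonempty (G ≃g joinGraph (⊤ : SimpleGraph (Fin d))
      ((⊤ : SimpleGraph (Fin b)) ⊕g (⊥ : SimpleGraph (Fin a)))) := by
  refine nonempty_iso_of_colouring
    (fun v => if v ∉ C then (0 : Fin 3) else if v ∉ A then 1 else 2)
    (Sum.elim (fun _ => 0) (Sum.elim (fun _ => 1) (fun _ => 2)))
    (fun i k => i = 0 ∨ k = 0 ∨ i = 1 ∧ k = 1) ![Cᶜ, C \ A, A]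
    (fun i v => ?_) (fun i => ?_) (fun u v => ?_) (fun u v => ?_)
  · have := @hAC v
    fin_cases i <;> simp <;> grind
  · fin_cases i <;> simp [card_filter_sum_elim_eq, hd, hb, ha]
  · rw [hadj]
    have hu := @hAC u
    have hv := @hAC v
    split_ifs <;> simp_all
  · rcases u with u | u | u <;> rcases v with v | v | v <;> simp [joinGraph, eq_comm]

theorem nonempty_iso_join_top_bot {V : Type*} [Fintype V] [DecidableEq V] {G : SimpleGraph V}
    {C : Finset V} {a d : ℕ} (hd : #Cᶜ = d) (ha : #C = a)
    (hadj : ∀ u v, G.Adj u v ↔ u ≠ v ∧ ¬(u ∈ C ∧ v ∈ C)) :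
    Nonempty (G ≃g joinGraph (⊤ : SimpleGraph (Fin d)) (⊥ : SimpleGraph (Fin a))) := by
  refine nonempty_iso_of_colouring (fun v => if v ∉ C then (0 : Fin 2) else 1)
    (Sum.elim (fun _ => 0) (fun _ => 1)) (fun i k => i = 0 ∨ k = 0) ![Cᶜ, C]
    (fun i v => ?_) (fun i => ?_) (fun u v => ?_) (fun u v => ?_)
  · fin_cases i <;> simp
  · fin_cases i <;> simp [card_filter_sum_elim_eq, hd, ha]
  · rw [hadj]
    split_ifs <;> simp_all
  · rcases u with u | u <;> rcases v with v | v <;> simp [joinGraph, eq_comm]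

theorem nonempty_iso_join_top_completeBipartiteGraph {V : Type*} [Fintype V] [DecidableEq V]
    {G : SimpleGraph V} {C : Finset V} {k d : ℕ} (hd : #Cᶜ = d + 2) (hk : #C = k) {a b : V}
    (hab : a ≠ b) (ha : a ∉ C) (hb : b ∉ C)
    (hadj : ∀ u v, G.Adj u v ↔ u ≠ v ∧ ¬(u ∈ C ∧ v ∈ C) ∧ s(u, v) ≠ s(a, b)) :
    Nonempty (G ≃g joinGraph (⊤ : SimpleGraph (Fin d))
      (completeBipartiteGraph (Fin 2) (Fin k))) := by
  have h2 : #(Cᶜ \ {a, b}) = d := by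
    rw [card_sdiff_of_subset (by simp [insert_subset_iff, ha, hb]), card_pair hab, hd,
      Nat.add_sub_cancel]
  refine nonempty_iso_of_colouring
    (fun v => if v ∈ C then (2 : Fin 3) else if v = a ∨ v = b then 1 else 0)
    (Sum.elim (fun _ => 0) (Sum.elim (fun _ => 1) (fun _ => 2)))
    (fun i k => i = 0 ∨ k = 0 ∨ i ≠ k) ![Cᶜ \ {a, b}, {a, b}, C]
    (fun i v => ?_) (fun i => ?_) (fun u v => ?_) (fun u v => ?_)
  · fin_cases i <;> simp <;> grind
  · fin_cases i <;> simp [card_filter_sum_elim_eq, h2, hk, card_pair hab]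
  · rw [hadj, ne_eq (Sym2.mk _ _), Sym2.eq_iff]
    grind
  · rcases u with u | u | u <;> rcases v with v | v | v <;>
      (simp [joinGraph]; try tauto)

/-- The colouring data of `K_j ∨ (j + 1)K₁` with one edge between the two parts removed. -/
theorem nonempty_iso_of_missing_cross_edge {V W : Type*} [Fintype V] [DecidableEq V] [Fintype W]
    {G : SimpleGraph V} {H : SimpleGraph W} {C : Finset V} {k d : ℕ} (hd : #Cᶜ = d + 1)
    (hk : #C = k + 1) {a b : V} (ha : a ∈ C) (hb : b ∉ C)
    (hadj : ∀ u v, G.Adj u v ↔ u ≠ v ∧ ¬(u ∈ C ∧ v ∈ C) ∧ s(u, v) ≠ s(a, b))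
    (f : W → Fin 4) (hf : ∀ i, #(univ.filter fun w => f w = i) = ![d, 1, k, 1] i)
    (hH : ∀ u v, H.Adj u v ↔
      u ≠ v ∧ (f u = 0 ∨ f v = 0 ∨ f u = 1 ∧ f v = 2 ∨ f u = 2 ∧ f v = 1)) :
    Nonempty (G ≃g H) := by
  refine nonempty_iso_of_colouring
    (fun v => if v = a then (3 : Fin 4) else if v = b then 1 else if v ∈ C then 2 else 0) f
    (fun i k => i = 0 ∨ k = 0 ∨ i = 1 ∧ k = 2 ∨ i = 2 ∧ k = 1)
    ![Cᶜ.erase b, {b}, C.erase a, {a}] (fun i v => ?_) (fun i => ?_) (fun u v => ?_) hH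
  · fin_cases i <;> simp <;> grind
  · rw [hf]
    fin_cases i <;> simp [ha, hb, hd, hk, card_erase_of_mem]
  · rw [hadj, ne_eq (Sym2.mk _ _), Sym2.eq_iff]
    grind

theorem nonempty_iso_join_bot_sum_star {V : Type*} [Fintype V] [DecidableEq V] {G : SimpleGraph V}
    {C : Finset V} {k d : ℕ} (hd : #Cᶜ = d + 1) (hk : #C = k + 1) {a b : V} (ha : a ∈ C)
    (hb : b ∉ C) (hadj : ∀ u v, G.Adj u v ↔ u ≠ v ∧ ¬(u ∈ C ∧ v ∈ C) ∧ s(u, v) ≠ s(a, b)) :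
    Nonempty (G ≃g joinGraph (⊤ : SimpleGraph (Fin d))
      ((⊥ : SimpleGraph (Fin 1)) ⊕g completeBipartiteGraph (Fin 1) (Fin k))) := by
  refine nonempty_iso_of_missing_cross_edge hd hk ha hb hadj
    (Sum.elim (fun _ => 0) (Sum.elim (fun _ => 3) (Sum.elim (fun _ => 1) (fun _ => 2))))
    (fun i => ?_) (fun u v => ?_)
  · fin_cases i <;> simp [card_filter_sum_elim_eq]
  · rcases u with u | u | u | u <;> rcases v with v | v | v | v <;>
      (simp [joinGraph]; try tauto)

theorem nonempty_iso_join_star_sum_bot {V : Type*} [Fintype V] [DecidableEq V] {G : SimpleGraph V}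
    {C : Finset V} {k d : ℕ} (hd : #Cᶜ = d + 1) (hk : #C = k + 1) {a b : V} (ha : a ∈ C)
    (hb : b ∉ C) (hadj : ∀ u v, G.Adj u v ↔ u ≠ v ∧ ¬(u ∈ C ∧ v ∈ C) ∧ s(u, v) ≠ s(a, b)) :
    Nonempty (G ≃g joinGraph (⊤ : SimpleGraph (Fin d))
      (completeBipartiteGraph (Fin 1) (Fin k) ⊕g (⊥ : SimpleGraph (Fin 1)))) := by
  refine nonempty_iso_of_missing_cross_edge hd hk ha hb hadj
    (Sum.elim (fun _ => 0) (Sum.elim (Sum.elim (fun _ => 1) (fun _ => 2)) (fun _ => 3)))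
    (fun i => ?_) (fun u v => ?_)
  · fin_cases i <;> simp [card_filter_sum_elim_eq]
  · rcases u with u | (u | u) | u <;> rcases v with v | (v | v) | v <;>
      (simp [joinGraph]; try tauto)

/-- Lemma 7: edge condition for traceability from every vertex, with exceptional graphs. -/
theorem stmt_12 {V : Type*} [Fintype V] [DecidableEq V] (G : SimpleGraph V) [DecidableRel G.Adj]
    (n : ℕ) (hn : Fintype.card V = n) (hn4 : 4 ≤ n)
    (hconn : G.Connected) (hδ : ∀ v : V, 2 ≤ G.degree v)
    (hm : Nat.choose (n - 2) 2 + 4 ≤ G.edgeFinset.card) :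
    TraceableFromEveryVertex G ∨
    Nonempty (G ≃g joinGraph (⊤ : SimpleGraph (Fin 2))
      ((⊤ : SimpleGraph (Fin (n - 4))) ⊕g (⊥ : SimpleGraph (Fin 2)))) ∨
    Nonempty (G ≃g joinGraph (⊤ : SimpleGraph (Fin 5)) (⊥ : SimpleGraph (Fin 6))) ∨
    Nonempty (G ≃g joinGraph (⊤ : SimpleGraph (Fin 3))
      ((⊤ : SimpleGraph (Fin 2)) ⊕g (⊥ : SimpleGraph (Fin 3)))) ∨
    Nonempty (G ≃g joinGraph (⊤ : SimpleGraph (Fin 4)) (⊥ : SimpleGraph (Fin 5))) ∨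
    Nonempty (G ≃g joinGraph (⊤ : SimpleGraph (Fin 3))
      (completeBipartiteGraph (Fin 1) (Fin 4) ⊕g (⊥ : SimpleGraph (Fin 1)))) ∨
    Nonempty (G ≃g joinGraph (⊤ : SimpleGraph (Fin 3))
      (completeBipartiteGraph (Fin 1) (Fin 3) ⊕g (⊤ : SimpleGraph (Fin 2)))) ∨
    Nonempty (G ≃g joinGraph (⊤ : SimpleGraph (Fin 2))
      (completeBipartiteGraph (Fin 2) (Fin 5))) ∨
    Nonempty (G ≃g joinGraph (⊤ : SimpleGraph (Fin 3)) (⊥ : SimpleGraph (Fin 4))) ∨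
    Nonempty (G ≃g joinGraph (⊤ : SimpleGraph (Fin 2))
      ((⊥ : SimpleGraph (Fin 1)) ⊕g completeBipartiteGraph (Fin 1) (Fin 3))) ∨
    Nonempty (G ≃g joinGraph (⊤ : SimpleGraph (Fin 2))
      (completeBipartiteGraph (Fin 1) (Fin 2) ⊕g (⊤ : SimpleGraph (Fin 2)))) ∨
    Nonempty (G ≃g joinGraph (⊤ : SimpleGraph (Fin 1))
      (completeBipartiteGraph (Fin 2) (Fin 4))) := by
  by_cases htr : ∀ x, HasHamiltonListFrom G x
  · exact Or.inl fun x => (htr x).exists_walk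
  right
  push Not at htr
  obtain ⟨x, hx⟩ := htr
  obtain ⟨H, _, hGH, htop, hH⟩ := exists_degree_closed_supergraph hx
  obtain ⟨w, A, C, hj, hAC, hA, hC, hdA, hdC⟩ := exists_low_degree_sets htop hH
  have hdeg : ∀ v, G.degree v ≤ H.degree v := fun v => degree_le_of_le hGH
  have hj2 : 2 ≤ H.degree w := (hδ w).trans (hdeg w)
  generalize H.degree w = j at *
  rw [hn] at hj hC hdC
  have hCc : #Cᶜ = j := by rw [card_compl]; omega
  have hCA : #(C \ A) = n - 2 * j := by rw [card_sdiff_of_subset hAC]; omega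
  have hchoose : 2 * (n - 2).choose 2 = (n - 2) * (n - 3) := by
    rw [Nat.choose_two_right, Nat.mul_div_cancel' (Nat.even_mul_pred_self _).two_dvd]
    rfl
  have hlow : (n - 2) * (n - 3) + 8 ≤ ∑ v, G.degree v := by
    rw [sum_degrees_eq_twice_card_edges]
    omega
  have hup : ∑ v, G.degree v ≤ j * j + (n - 2 * j) * (n - 1 - j) + j * (n - 1) := by
    rw [← sum_degree_bounds hn hAC hA hC hj]
    refine sum_le_sum fun v _ => ?_
    have := G.degree_lt_card_verts v
    split_ifs with h1 h2
    · exact (hdeg v).trans (hdA v h1)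
    · exact (hdeg v).trans (hdC v h2)
    · omega
  have htight := adj_iff_of_degrees_tight hn hAC hA hC hj
    (fun v hv => (hdeg v).trans (hdA v hv)) (fun v hv => (hdeg v).trans (hdC v hv))
  rcases eq_of_degree_sum_bound hj2 hj (hlow.trans hup) with rfl | ⟨rfl, rfl⟩ | ⟨rfl, hj'⟩
  · left
    refine nonempty_iso_join_top_sum_bot hAC hCc hCA hA (htight (le_trans ?_ hlow))
    obtain ⟨k, rfl⟩ := Nat.exists_eq_add_of_le hn4
    have e1 : 4 + k - 2 = k + 2 := by omega
    have e2 : 4 + k - 3 = k + 1 := by omega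
    have e3 : 4 + k - 2 * 2 = k := by omega
    have e4 : 4 + k - 1 - 2 = k + 1 := by omega
    have e5 : 4 + k - 1 = k + 3 := by omega
    rw [e1, e2, e3, e4, e5]
    nlinarith
  · right; right; left
    exact nonempty_iso_join_top_sum_bot hAC hCc hCA hA (htight (le_trans (by norm_num) hlow))
  · have hC' : #C = j + 1 := by omega
    have hlow' : (2 * j - 1) * (2 * j - 2) + 8 ≤ ∑ v, H.degree v :=
      hlow.trans (sum_le_sum fun v _ => hdeg v)
    have hind : ∀ a ∈ C, ∀ b ∈ C, ¬G.Adj a b := fun a ha b hb hab =>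
      not_adj_of_low_degree hn (by omega) hC' (fun v hv => (hdC v hv).trans (by omega)) hH hlow'
        ha hb (hGH hab)
    rw [sum_degrees_eq_twice_card_edges] at hlow
    rcases adj_iff_of_independent hn hC' hind
      (by rcases hj' with rfl | rfl | rfl <;> norm_num at hlow ⊢ <;> omega) with
      hadj | ⟨hle, a, b, hab, hnot, hadj⟩
    · have hiso := nonempty_iso_join_top_bot hCc hC' hadj
      rcases hj' with rfl | rfl | rfl
      · iterate 7 right
        exact Or.inl hiso
      · iterate 3 right
        exact Or.inl hiso
      · right
        exact Or.inl hiso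
    · have hcases : a ∉ C ∧ b ∉ C ∨ a ∈ C ∧ b ∉ C ∨ b ∈ C ∧ a ∉ C := by tauto
      rcases hcases with ⟨ha, hb⟩ | hcross
      · rcases hj' with rfl | rfl | rfl
        · iterate 10 right
          exact nonempty_iso_join_top_completeBipartiteGraph hCc hC' hab ha hb hadj
        · iterate 6 right
          exact Or.inl (nonempty_iso_join_top_completeBipartiteGraph hCc hC' hab ha hb hadj)
        · norm_num at hlow hle
          omega
      · obtain ⟨a, b, ha, hb, hadj⟩ : ∃ a b, a ∈ C ∧ b ∉ C ∧ ∀ u v, G.Adj u v ↔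
            u ≠ v ∧ ¬(u ∈ C ∧ v ∈ C) ∧ s(u, v) ≠ s(a, b) := by
          rcases hcross with ⟨ha, hb⟩ | ⟨hb, ha⟩
          · exact ⟨a, b, ha, hb, hadj⟩
          · exact ⟨b, a, hb, ha, by simpa only [Sym2.eq_swap (a := b)] using hadj⟩
        rcases hj' with rfl | rfl | rfl
        · iterate 8 right
          exact Or.inl (nonempty_iso_join_bot_sum_star hCc hC' ha hb hadj)
        · iterate 4 right
          exact Or.inl (nonempty_iso_join_star_sum_bot hCc hC' ha hb hadj)
        · norm_num at hlow hle
          omega
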